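/- Let $G$ be a comonad on $\mathcal{A}$, $L \dashv R$ an adjunction with $L : \mathcal{B} \to \mathcal{A}$, and $\varphi : LR \to G$ a morphism of comonads. Assume the equalizer of $(\alpha_X, Rx)$ exists in $\mathcal{B}$ for every $G$-coalgebra $(X,x)$. Then $K_\varphi : \mathcal{B} \to \mathcal{A}^G$ is an equivalence of categories if and only if $L$ preserves the equalizers of the form $D_\varphi X \to RX \rightrightarrows RGX$, $L$ reflects isomorphisms, and $\varphi$ is an isomorphism of comonads. -/

import Mathlib

open CategoryTheory CategoryTheory.Limits

namespace CategoryTheory.Comonad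

variable {A : Type*} {B : Type*} [Category A] [Category B] {G : Comonad A} {L : B ⥤ A}
  {R : A ⥤ B} (adj : L ⊣ R)

/-- The compatibility of `p : L R ⟶ G` with the comonad structures of `L R` and `G`. -/
structure IsComonadHom (p : R ⋙ L ⟶ G.toFunctor) : Prop where
  app_counit (X : A) : p.app X ≫ G.ε.app X = adj.counit.app X
  app_comul (X : A) : p.app X ≫ G.δ.app X =
    L.map (adj.unit.app (R.obj X)) ≫ p.app (L.obj (R.obj X)) ≫ G.map (p.app X)

/-- The transformation `α = R p ∘ η R` induced by `p : L R ⟶ G`. -/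
abbrev alpha (p : R ⋙ L ⟶ G.toFunctor) (X : A) : R.obj X ⟶ R.obj (G.obj X) :=
  adj.unit.app (R.obj X) ≫ R.map (p.app X)

/-- The coaction on `L.obj Y` induced by `p : L R ⟶ G`. -/
abbrev coaction (p : R ⋙ L ⟶ G.toFunctor) (Y : B) : L.obj Y ⟶ G.obj (L.obj Y) :=
  L.map (adj.unit.app Y) ≫ p.app (L.obj Y)

variable {adj} {p : R ⋙ L ⟶ G.toFunctor}

theorem map_comp_app {X X' : A} (f : X ⟶ X') :
    L.map (R.map f) ≫ p.app X' = p.app X ≫ G.map f :=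
  p.naturality f

theorem coaction_naturality {Y Y' : B} (f : Y ⟶ Y') :
    coaction adj p Y ≫ G.map (L.map f) = L.map f ≫ coaction adj p Y' := by
  simp only [coaction, Category.assoc]
  rw [← map_comp_app, ← L.map_comp_assoc, ← L.map_comp_assoc, adj.unit_naturality]

theorem map_homEquiv_comp_counit {X : A} {Y : B} (f : L.obj Y ⟶ X) :
    L.map (adj.homEquiv Y X f) ≫ adj.counit.app X = f := by
  simpa only [adj.homEquiv_counit] using (adj.homEquiv Y X).symm_apply_apply f

/-- The coaction composed with the image of an adjunct. -/
theorem coaction_comp_map_adjunct {X : A} {Y : B} (k : Y ⟶ R.obj X) :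
    coaction adj p Y ≫ G.map (L.map k ≫ adj.counit.app X) = L.map k ≫ p.app X := by
  rw [G.map_comp, ← Category.assoc, coaction_naturality]
  simp only [coaction, Category.assoc]
  rw [← map_comp_app, ← L.map_comp_assoc (adj.unit.app _), adj.right_triangle_components]
  simp

/-- `p` intertwines `L α` with the comultiplication. -/
theorem IsComonadHom.map_alpha_comp (hp : IsComonadHom adj p) (X : A) :
    L.map (alpha adj p X) ≫ p.app (G.obj X) = p.app X ≫ G.δ.app X := by
  rw [hp.app_comul, L.map_comp, Category.assoc, map_comp_app]

/-- The lifting of `L` to `G`-coalgebras determined by `p`. -/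
@[simps]
abbrev IsComonadHom.lifting (hp : IsComonadHom adj p) : B ⥤ G.Coalgebra where
  obj Y :=
    { A := L.obj Y
      a := coaction adj p Y
      counit := by simp [hp.app_counit]
      coassoc := by
        rw [G.map_comp, ← Category.assoc (coaction adj p Y), coaction_naturality]
        simp [hp.app_comul] }
  map f :=
    { f := L.map f
      h := coaction_naturality f }

/-- A morphism `k : Y ⟶ R X` equalizes `α` and `R x` iff its adjunct is a coalgebra morphism. -/
theorem comp_alpha_eq_iff {X : G.Coalgebra} {Y : B} (k : Y ⟶ R.obj X.A) :
    k ≫ alpha adj p X.A = k ≫ R.map X.a ↔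
      coaction adj p Y ≫ G.map (L.map k ≫ adj.counit.app X.A) =
        (L.map k ≫ adj.counit.app X.A) ≫ X.a := by
  rw [coaction_comp_map_adjunct, ← (adj.homEquiv Y _).symm.injective.eq_iff]
  simp [adj.homEquiv_counit]

/-- The coalgebra morphism adjunct to a morphism equalizing `α` and `R x`. -/
@[simps]
abbrev IsComonadHom.adjunct (hp : IsComonadHom adj p) {X : G.Coalgebra} {Y : B}
    (k : Y ⟶ R.obj X.A) (hk : k ≫ alpha adj p X.A = k ≫ R.map X.a) :
    hp.lifting.obj Y ⟶ X where
  f := L.map k ≫ adj.counit.app X.A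
  h := (comp_alpha_eq_iff k).1 hk

theorem adjunct_comp_a {X : G.Coalgebra} {Y : B}
    {k : Y ⟶ R.obj X.A} (hk : k ≫ alpha adj p X.A = k ≫ R.map X.a) :
    (L.map k ≫ adj.counit.app X.A) ≫ X.a = L.map k ≫ p.app X.A := by
  rw [← (comp_alpha_eq_iff k).1 hk, coaction_comp_map_adjunct]

theorem mono_coalgebra_a (X : G.Coalgebra) : Mono X.a :=
  have : IsSplitMono X.a := ⟨⟨⟨G.ε.app X.A, X.counit⟩⟩⟩
  inferInstance

/-- If `L` preserves the equalizer `k` of `α` and `R x`, and `p` is invertible, then the adjunct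
of `k` is invertible. -/
theorem IsComonadHom.isIso_adjunct (hp : IsComonadHom adj p) [∀ X, IsIso (p.app X)]
    {X : G.Coalgebra} {Y : B} {k : Y ⟶ R.obj X.A}
    (hk : k ≫ alpha adj p X.A = k ≫ R.map X.a)
    (hl : IsLimit (Fork.ofι (f := L.map (alpha adj p X.A)) (g := L.map (R.map X.a)) (L.map k)
      (by rw [← L.map_comp, hk, L.map_comp]))) :
    IsIso (L.map k ≫ adj.counit.app X.A) := by
  have hx : (X.a ≫ inv (p.app X.A)) ≫ L.map (alpha adj p X.A) =
      (X.a ≫ inv (p.app X.A)) ≫ L.map (R.map X.a) := by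
    rw [← cancel_mono (p.app (G.obj X.A)), Category.assoc, Category.assoc, hp.map_alpha_comp,
      Category.assoc, Category.assoc, map_comp_app]
    simp [X.coassoc]
  obtain ⟨l, hl'⟩ := Fork.IsLimit.lift' hl _ hx
  have hl' : l ≫ L.map k = X.a ≫ inv (p.app X.A) := hl'
  have := mono_coalgebra_a X
  refine ⟨l, ?_, ?_⟩
  · refine Fork.IsLimit.hom_ext hl ?_
    change (_ ≫ l) ≫ L.map k = 𝟙 _ ≫ L.map k
    rw [Category.assoc, hl', ← Category.assoc, adjunct_comp_a hk]
    simp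
  · rw [← cancel_mono X.a, Category.assoc, adjunct_comp_a hk, ← Category.assoc, hl']
    simp

/-- If the adjunct of `k` and `p` are invertible, then `L k` is an equalizer. -/
theorem IsComonadHom.isLimit_of_isIso_adjunct (hp : IsComonadHom adj p) [∀ X, IsIso (p.app X)]
    {X : G.Coalgebra} {Y : B} {k : Y ⟶ R.obj X.A}
    (hk : k ≫ alpha adj p X.A = k ≫ R.map X.a)
    [IsIso (L.map k ≫ adj.counit.app X.A)] :
    Nonempty (IsLimit (Fork.ofι (f := L.map (alpha adj p X.A)) (g := L.map (R.map X.a)) (L.map k)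
      (by rw [← L.map_comp, hk, L.map_comp]))) := by
  have := mono_coalgebra_a X
  have hc := adjunct_comp_a hk
  have : Mono (L.map k) := by
    have : Mono (L.map k ≫ p.app X.A) := by rw [← hc]; infer_instance
    exact mono_of_mono _ (p.app X.A)
  refine ⟨Fork.IsLimit.mk' _ fun s => ⟨(s.ι ≫ adj.counit.app X.A) ≫
    inv (L.map k ≫ adj.counit.app X.A), ?_, fun {m} hm => ?_⟩⟩
  · change _ ≫ L.map k = _
    have hs := (s.condition =≫ p.app (G.obj X.A)) =≫ G.ε.app (G.obj X.A)
    simp only [Category.assoc] at hs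
    rw [reassoc_of% hp.map_alpha_comp, ← Category.assoc (L.map (R.map X.a)), map_comp_app] at hs
    have hn := G.ε.naturality X.a
    dsimp at hn
    simp only [Category.assoc, hn, Comonad.left_counit, Category.comp_id] at hs
    rw [← cancel_mono (p.app X.A), Category.assoc, ← hc, Category.assoc, IsIso.inv_hom_id_assoc,
      ← hp.app_counit, hs]
    simp
  · have hm : m ≫ L.map k = s.ι := hm
    rw [← hm]
    simp

/-- The coalgebra morphism `lifting (R X) ⟶ cofree X` with underlying morphism `p`. -/
def IsComonadHom.toCofree (hp : IsComonadHom adj p) (X : A) :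
    hp.lifting.obj (R.obj X) ⟶ G.cofree.obj X where
  f := p.app X
  h := by
    have h := hp.app_comul X
    rw [← Category.assoc] at h
    exact h.symm

/-- A coalgebra morphism to a cofree coalgebra is determined by its composite with the counit. -/
theorem cofree_hom_ext {Y : G.Coalgebra} {X : A} {f g : Y ⟶ G.cofree.obj X}
    (h : f.f ≫ G.ε.app X = g.f ≫ G.ε.app X) : f = g := by
  have key (t : Y.A ⟶ G.obj X) (ht : Y.a ≫ G.map t = t ≫ G.δ.app X) :
      Y.a ≫ G.map (t ≫ G.ε.app X) = t := by
    rw [G.map_comp, reassoc_of% ht, G.right_counit, Category.comp_id]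
  ext
  exact (key f.f f.h).symm.trans ((congrArg (Y.a ≫ G.map ·) h).trans (key g.f g.h))

theorem IsComonadHom.isIso_app_of_isEquivalence (hp : IsComonadHom adj p)
    [hp.lifting.IsEquivalence] (X : A) : IsIso (p.app X) := by
  let e := hp.lifting.objObjPreimageIso (G.cofree.obj X)
  let k := adj.homEquiv _ X (e.hom.f ≫ G.ε.app X)
  have hk : hp.lifting.map k ≫ hp.toCofree X = e.hom := by
    apply cofree_hom_ext
    change (L.map k ≫ p.app X) ≫ G.ε.app X = _
    rw [Category.assoc, hp.app_counit]
    exact map_homEquiv_comp_counit _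
  let s := e.inv ≫ hp.lifting.map k
  have hs : s ≫ hp.toCofree X = 𝟙 _ := by
    rw [Category.assoc, hk, e.inv_hom_id]
  have hs' : hp.toCofree X ≫ s = 𝟙 _ := by
    obtain ⟨m, hm⟩ := hp.lifting.map_surjective (hp.toCofree X ≫ s)
    have hm₁ : L.map m ≫ p.app X = p.app X :=
      congrArg Coalgebra.Hom.f (show hp.lifting.map m ≫ hp.toCofree X = hp.toCofree X by
        rw [hm, Category.assoc, hs, Category.comp_id])
    have hm₂ : m = 𝟙 _ := by
      apply (adj.homEquiv _ _).symm.injective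
      rw [adj.homEquiv_counit, adj.homEquiv_counit, ← hp.app_counit, reassoc_of% hm₁, L.map_id,
        Category.id_comp]
    rw [← hm, hm₂, Functor.map_id]
  exact ⟨s.f, congrArg Coalgebra.Hom.f hs', congrArg Coalgebra.Hom.f hs⟩

/-- If the lifting is an equivalence then `L` preserves the equalizers of `α` and `R x`. -/
theorem IsComonadHom.preservesLimit_of_isEquivalence (hp : IsComonadHom adj p)
    [hp.lifting.IsEquivalence] (X : G.Coalgebra) :
    PreservesLimit (parallelPair (alpha adj p X.A) (R.map X.a)) L := by
  have := hp.isIso_app_of_isEquivalence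
  let e := hp.lifting.objObjPreimageIso X
  let k := adj.homEquiv _ _ e.hom.f
  have hkc : L.map k ≫ adj.counit.app X.A = e.hom.f :=
    map_homEquiv_comp_counit _
  have hk : k ≫ alpha adj p X.A = k ≫ R.map X.a := by
    rw [comp_alpha_eq_iff, hkc]
    exact e.hom.h
  have : IsIso (L.map k ≫ adj.counit.app X.A) := by
    rw [hkc]
    exact inferInstanceAs (IsIso (G.forget.map e.hom))
  have hlim : IsLimit (Fork.ofι k hk) := by
    refine Fork.IsLimit.mk' _ fun s =>
      ⟨hp.lifting.preimage (hp.adjunct s.ι s.condition ≫ e.inv), ?_, fun {m} hm => ?_⟩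
    · change _ ≫ k = _
      apply (adj.homEquiv _ _).symm.injective
      have hf := congrArg Coalgebra.Hom.f
        (hp.lifting.map_preimage (hp.adjunct s.ι s.condition ≫ e.inv) =≫ e.hom)
      simp only [Category.assoc, e.inv_hom_id, Category.comp_id, Coalgebra.comp_f] at hf
      rw [adj.homEquiv_counit, adj.homEquiv_counit, L.map_comp, Category.assoc, hkc]
      exact hf
    · have hm : m ≫ k = s.ι := hm
      apply hp.lifting.map_injective
      rw [Functor.map_preimage, Iso.eq_comp_inv]
      ext
      simp [← hm, ← hkc]
  refine preservesLimit_of_preserves_limit_cone hlim ?_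
  exact (isLimitMapConeForkEquiv L hk).symm (hp.isLimit_of_isIso_adjunct hk).some

theorem IsComonadHom.reflectsIsomorphisms_of_isEquivalence (hp : IsComonadHom adj p)
    [hp.lifting.IsEquivalence] : L.ReflectsIsomorphisms :=
  inferInstanceAs (hp.lifting ⋙ G.forget).ReflectsIsomorphisms

theorem IsComonadHom.isEquivalence_lifting (hp : IsComonadHom adj p) [∀ X, IsIso (p.app X)]
    [L.ReflectsIsomorphisms]
    [∀ X : G.Coalgebra, HasEqualizer (alpha adj p X.A) (R.map X.a)]
    [∀ X : G.Coalgebra, PreservesLimit (parallelPair (alpha adj p X.A) (R.map X.a)) L] :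
    hp.lifting.IsEquivalence := by
  let ι (X : G.Coalgebra) := equalizer.ι (alpha adj p X.A) (R.map X.a)
  have hι (X : G.Coalgebra) : ι X ≫ alpha adj p X.A = ι X ≫ R.map X.a :=
    equalizer.condition _ _
  have hc (X : G.Coalgebra) : IsIso (L.map (ι X) ≫ adj.counit.app X.A) :=
    hp.isIso_adjunct (hι X) (isLimitForkMapOfIsLimit L (hι X) (equalizerIsEqualizer _ _))
  have hη (Y : B) : adj.unit.app Y ≫ alpha adj p (hp.lifting.obj Y).A =
      adj.unit.app Y ≫ R.map (hp.lifting.obj Y).a := by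
    refine (comp_alpha_eq_iff (X := hp.lifting.obj Y) _).2 ?_
    simp
  let u (Y : B) : Y ⟶ equalizer (alpha adj p (hp.lifting.obj Y).A) (R.map (hp.lifting.obj Y).a) :=
    equalizer.lift (adj.unit.app Y) (hη Y)
  have hu (Y : B) : u Y ≫ ι _ = adj.unit.app Y := equalizer.lift_ι _ _
  have hu' (Y : B) : IsIso (u Y) := by
    have h : L.map (u Y) ≫ L.map (ι _) ≫ adj.counit.app (L.obj Y) = 𝟙 _ := by
      rw [← L.map_comp_assoc, hu, adj.left_triangle_components]
    have := hc (hp.lifting.obj Y)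
    have : IsIso (L.map (u Y)) := by
      rw [← IsIso.eq_comp_inv] at h
      rw [h]
      infer_instance
    exact isIso_of_reflects_iso _ L
  have : hp.lifting.Faithful := ⟨fun {Y Z f g} hfg => by
    have hfg : L.map f = L.map g := congrArg Coalgebra.Hom.f hfg
    rw [← cancel_mono (u Z), ← cancel_mono (ι _), Category.assoc, Category.assoc, hu,
      ← adj.unit_naturality, hfg, adj.unit_naturality]⟩
  have : hp.lifting.Full := ⟨fun {Y Z} f => by
    have hf : adj.homEquiv _ _ f.f ≫ alpha adj p (hp.lifting.obj Z).A =
        adj.homEquiv _ _ f.f ≫ R.map (hp.lifting.obj Z).a := by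
      rw [comp_alpha_eq_iff, map_homEquiv_comp_counit]
      exact f.h
    refine ⟨equalizer.lift _ hf ≫ inv (u Z), Coalgebra.Hom.ext ?_⟩
    apply (adj.homEquiv _ _).injective
    refine Eq.trans ?_ (equalizer.lift_ι _ hf)
    rw [adj.homEquiv_unit]
    change _ ≫ R.map (L.map _) = _
    rw [adj.unit_naturality, ← hu, Category.assoc, IsIso.inv_hom_id_assoc]⟩
  have : hp.lifting.EssSurj := ⟨fun X => ⟨_, ⟨by
    have : IsIso (G.forget.map (hp.adjunct (ι X) (hι X))) := hc X
    have := isIso_of_reflects_iso (hp.adjunct (ι X) (hι X)) G.forget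
    exact asIso (hp.adjunct (ι X) (hι X))⟩⟩⟩
  exact { }

end CategoryTheory.Comonad

/-- in the setting of the lifted functor `K_φ` and its right adjoint `D_φ`
(defined via equalizers, assumed to exist), `K_φ` is an equivalence of categories between `B`
and `A^G` if and only if `L` preserves the equalizers of the form `D_φ X ⟶ RX ⇉ RGX`,
`L` reflects isomorphisms, and `φ` is an isomorphism of comonads. -/
theorem stmt11 {A : Type*} {B : Type*} [Category A] [Category B]
    (G : Comonad A) (L : B ⥤ A) (R : A ⥤ B) (adj : L ⊣ R)
    (φ : adj.toComonad ⟶ G)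
    (K : B ⥤ G.Coalgebra)
    (hK : K ⋙ G.forget = L)
    (hKa : ∀ Y : B, HEq (K.obj Y).a (L.map (adj.unit.app Y) ≫ φ.app (L.obj Y)))
    (hKf : ∀ Y Z : B, ∀ f : Y ⟶ Z, HEq (K.map f).f (L.map f))
    (heq : ∀ X : G.Coalgebra,
      HasEqualizer (adj.unit.app (R.obj X.A) ≫ R.map (φ.app X.A)) (R.map X.a)) :
    K.IsEquivalence ↔
      ((∀ X : G.Coalgebra,
          Nonempty (PreservesLimit
            (parallelPair (adj.unit.app (R.obj X.A) ≫ R.map (φ.app X.A)) (R.map X.a)) L)) ∧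
        L.ReflectsIsomorphisms ∧ IsIso φ) := by
  let p : R ⋙ L ⟶ G.toFunctor := φ.toNatTrans
  have hp : Comonad.IsComonadHom adj p :=
    ⟨fun X => φ.app_ε X, fun X => φ.app_δ X⟩
  have e : K ≅ hp.lifting := by
    subst hK
    refine NatIso.ofComponents (fun Y => Comonad.Coalgebra.isoMk (Iso.refl _) ?_) ?_
    · refine Eq.trans ?_ ((eq_of_heq (hKa Y)).trans (Category.id_comp _).symm)
      exact (congrArg ((K.obj Y).a ≫ ·) (G.map_id _)).trans (Category.comp_id _)
    · intro Y Z f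
      ext
      exact (Category.comp_id _).trans (Category.id_comp _).symm
  constructor
  · intro hK'
    have := Functor.isEquivalence_of_iso e
    refine ⟨fun X => ⟨hp.preservesLimit_of_isEquivalence X⟩,
      hp.reflectsIsomorphisms_of_isEquivalence, ?_⟩
    have := hp.isIso_app_of_isEquivalence
    have : IsIso ((comonadToFunctor A).map φ) := NatIso.isIso_of_isIso_app p
    exact isIso_of_reflects_iso φ (comonadToFunctor A)
  · rintro ⟨hpres, hrefl, hφ⟩
    have (X : A) : IsIso (p.app X) :=
      inferInstanceAs (IsIso (((comonadToFunctor A).map φ).app X))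
    have (X : G.Coalgebra) : HasEqualizer (Comonad.alpha adj p X.A) (R.map X.a) := heq X
    have (X : G.Coalgebra) :
        PreservesLimit (parallelPair (Comonad.alpha adj p X.A) (R.map X.a)) L := (hpres X).some
    have := hp.isEquivalence_lifting
    exact Functor.isEquivalence_of_iso e.symm
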